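/- Let 1 ≤ q < ∞. There is a constant C(q) depending only on q such that for every real array A = (a_{ijk})_{i,j≤n,k≤m} with ∑ⱼ a_{ijk}² > 0 for all i,k, every p ≥ 1 and every U ⊆ B₂ⁿ + √p·B₁ⁿ: E^g sup_{x∈U} E^{g'} sup_{t∈B_{q'}} ∑_{ijk} a_{ijk} gᵢ g'ᵢ x_j t_k ≤ C(q) · (∑_k (∑_{ij} a_{ijk}²)^{q/2})^{1/(2q)} · sup_{x∈U} φ_A(x), where g₁,…,gₙ and g'₁,…,g'ₙ are independent i.i.d. standard Gaussian sequences and E^g, E^{g'} denote expectations in (gᵢ) and (g'ᵢ) respectively. -/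

import Mathlib

open MeasureTheory ProbabilityTheory Set
open scoped ENNReal BigOperators Pointwise

noncomputable section

namespace Stmt10

/-- the symmetric exponential distribution on `ℝ`, with density `e^{-|x|}/2`. -/
def symExp : Measure ℝ :=
  MeasureTheory.volume.withDensity fun x => ENNReal.ofReal (Real.exp (-|x|) / 2)

/-- the law of `Eₙ`, a vector of `n` i.i.d. symmetric exponential variables. -/
def expVec (n : ℕ) : Measure (Fin n → ℝ) := Measure.pi fun _ => symExp

/-- the law of a standard Gaussian vector in `ℝⁿ`. -/
def gaussVec (n : ℕ) : Measure (Fin n → ℝ) := Measure.pi fun _ => gaussianReal 0 1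

/-- the law of an `n × n` array of i.i.d. standard Gaussian variables. -/
def gaussMat (n : ℕ) : Measure (Fin n × Fin n → ℝ) := Measure.pi fun _ => gaussianReal 0 1

variable {n m : ℕ}

/-- `α_A(y) = √(∑ᵢ (∑_{jk} a_{ijk} y_{jk})²)` for `y ∈ ℝ^{n×m}`. -/
def alphaA (A : Fin n → Fin n → Fin m → ℝ) (y : Fin n → Fin m → ℝ) : ℝ :=
  Real.sqrt (∑ i, (∑ j, ∑ k, A i j k * y j k) ^ 2)

/-- `α_{∞,A}(y) = maxᵢ |∑_{jk} a_{ijk} y_{jk}|`. -/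
def alphaInf (A : Fin n → Fin n → Fin m → ℝ) (y : Fin n → Fin m → ℝ) : ℝ :=
  ⨆ i, |∑ j, ∑ k, A i j k * y j k|

/-- `x ⊗ t = (x_j t_k)_{jk}`. -/
def tens (x : Fin n → ℝ) (t : Fin m → ℝ) : Fin n → Fin m → ℝ := fun j k => x j * t k

/-- the distance `d_A((x,t),(x',t')) = α_A(x⊗t − x'⊗t')`. -/
def dA (A : Fin n → Fin n → Fin m → ℝ) (z w : (Fin n → ℝ) × (Fin m → ℝ)) : ℝ :=
  alphaA A (tens z.1 z.2 - tens w.1 w.2)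

/-- the distance `d_{∞,A}((x,t),(x',t')) = α_{∞,A}(x⊗t − x'⊗t')`. -/
def dInf (A : Fin n → Fin n → Fin m → ℝ) (z w : (Fin n → ℝ) × (Fin m → ℝ)) : ℝ :=
  alphaInf A (tens z.1 z.2 - tens w.1 w.2)

/-- the diameter of `V` in the metric `d_A`. -/
def diamA (A : Fin n → Fin n → Fin m → ℝ) (V : Set ((Fin n → ℝ) × (Fin m → ℝ))) : ℝ :=
  ⨆ z ∈ V, ⨆ w ∈ V, dA A z w

/-- the diameter of `V` in the metric `d_{∞,A}`. -/
def diamInf (A : Fin n → Fin n → Fin m → ℝ) (V : Set ((Fin n → ℝ) × (Fin m → ℝ))) : ℝ :=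
  ⨆ z ∈ V, ⨆ w ∈ V, dInf A z w

/-- `F_A(V) = E sup_{(x,t)∈V} ∑_{ijk} a_{ijk} gᵢ x_j t_k`. -/
def FA (A : Fin n → Fin n → Fin m → ℝ) (V : Set ((Fin n → ℝ) × (Fin m → ℝ))) : ℝ :=
  ∫ g, (⨆ z ∈ V, ∑ i, ∑ j, ∑ k, A i j k * g i * z.1 j * z.2 k) ∂gaussVec n

/-- `β_{A,T}(x) = E sup_{s∈T} |∑_{ijk} a_{ijk} gᵢ x_j s_k|`. -/
def betaA (A : Fin n → Fin n → Fin m → ℝ) (T : Set (Fin m → ℝ)) (x : Fin n → ℝ) : ℝ :=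
  ∫ g, (⨆ s ∈ T, |∑ i, ∑ j, ∑ k, A i j k * g i * x j * s k|) ∂gaussVec n

/-- `s_A(T) = E sup_{t∈T} |∑_{ijk} a_{ijk} g_{ij} t_k| + E sup_{t∈T} |∑_{ijk} a_{ijk} gᵢ ℰⱼ t_k|`. -/
def sA (A : Fin n → Fin n → Fin m → ℝ) (T : Set (Fin m → ℝ)) : ℝ :=
  (∫ G, (⨆ t ∈ T, |∑ i, ∑ j, ∑ k, A i j k * G (i, j) * t k|) ∂gaussMat n) +
  (∫ w, (⨆ t ∈ T, |∑ i, ∑ j, ∑ k, A i j k * w.1 i * w.2 j * t k|)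
      ∂((gaussVec n).prod (expVec n)))

/-- `E α_A(Eₙ ⊗ t)`. -/
def expAlpha (A : Fin n → Fin n → Fin m → ℝ) (t : Fin m → ℝ) : ℝ :=
  ∫ e, alphaA A (tens e t) ∂expVec n

/-- the closed Euclidean unit ball `B₂ⁿ`. -/
def B2 (n : ℕ) : Set (Fin n → ℝ) := {x | Real.sqrt (∑ i, x i ^ 2) ≤ 1}

/-- the closed `ℓ₁` unit ball `B₁ⁿ`. -/
def B1 (n : ℕ) : Set (Fin n → ℝ) := {x | ∑ i, |x i| ≤ 1}

/-- the Minkowski sum `B₂ⁿ + √p·B₁ⁿ`. -/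
def UB (n : ℕ) (p : ℝ) : Set (Fin n → ℝ) := B2 n + Real.sqrt p • B1 n

/-- `s_q(A) = (∑_k (∑_{ij} a_{ijk}²)^{q/2})^{1/q}`. -/
def sq (q : ℝ) (A : Fin n → Fin n → Fin m → ℝ) : ℝ :=
  (∑ k, (∑ i, ∑ j, A i j k ^ 2) ^ (q / 2)) ^ (1 / q)

/-- `φ_A(x) = (∑_k (∑ᵢ (∑ⱼ a_{ijk} x_j)⁴ / ∑ⱼ a_{ijk}²)^{q/2})^{1/(2q)}`. -/
def phiA (q : ℝ) (A : Fin n → Fin n → Fin m → ℝ) (x : Fin n → ℝ) : ℝ :=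
  (∑ k, (∑ i, (∑ j, A i j k * x j) ^ 4 / ∑ j, A i j k ^ 2) ^ (q / 2)) ^ (1 / (2 * q))

/-- `B_{q'} = {t ∈ ℝᵐ : ∑_k |t_k|^{q'} ≤ 1}`. -/
def Bconj (q' : ℝ) (m : ℕ) : Set (Fin m → ℝ) := {t | ∑ k, |t k| ^ q' ≤ 1}


instance : IsProbabilityMeasure (gaussVec n) := by
  unfold gaussVec
  infer_instance

lemma measurable_linear (c : Fin n → ℝ) : Measurable fun g : Fin n → ℝ => ∑ i, c i * g i := by
  fun_prop

lemma map_linear_gaussVec (c : Fin n → ℝ) :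
    (gaussVec n).map (fun g => ∑ i, c i * g i) =
      (gaussianReal 0 1).map (fun x => √(∑ i, c i ^ 2) * x) := by
  rw [gaussianReal_map_const_mul]
  have := Measure.isProbabilityMeasure_map (μ := gaussVec n)
    (measurable_linear c).aemeasurable
  refine Measure.ext_of_charFun (funext fun t => ?_)
  rw [charFun_apply_real, integral_map (measurable_linear c).aemeasurable (by fun_prop),
    charFun_gaussianReal]
  have hexp : ∀ g : Fin n → ℝ, Complex.exp (t * (∑ i, c i * g i : ℝ) * Complex.I) =
      ∏ i, Complex.exp ((c i * t : ℝ) * g i * Complex.I) := by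
    intro g
    rw [← Complex.exp_sum]
    congr 1
    push_cast
    rw [Finset.mul_sum, Finset.sum_mul]
    exact Finset.sum_congr rfl fun i _ => by ring
  simp_rw [hexp, gaussVec]
  rw [integral_fintype_prod_eq_prod (fun i (x : ℝ) =>
    Complex.exp ((c i * t : ℝ) * x * Complex.I))]
  simp_rw [← charFun_apply_real, charFun_gaussianReal, ← Complex.exp_sum]
  congr 1
  have hs : (√(∑ i, c i ^ 2)) ^ 2 = ∑ i, c i ^ 2 :=
    Real.sq_sqrt (Finset.sum_nonneg fun i _ => sq_nonneg _)
  simp [hs, Finset.sum_mul, Finset.sum_div, mul_pow]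

/-- the absolute moment of order `r` of a standard Gaussian variable. -/
def absMoment (r : ℝ) : ℝ := ∫ x, |x| ^ r ∂gaussianReal 0 1

lemma absMoment_nonneg (r : ℝ) : 0 ≤ absMoment r :=
  integral_nonneg fun _ => Real.rpow_nonneg (abs_nonneg _) _

lemma integrable_abs_rpow_gaussianReal {r : ℝ} (hr : 0 < r) :
    Integrable (fun x : ℝ => |x| ^ r) (gaussianReal 0 1) := by
  have h := (memLp_id_gaussianReal (μ := 0) (v := 1) (Real.toNNReal r)).integrable_norm_rpow
    (by simpa using hr) (by simp)
  simpa [hr.le] using h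

lemma abs_sqrt_mul_rpow {s : ℝ} (hs : 0 ≤ s) (x r : ℝ) :
    |√s * x| ^ r = s ^ (r / 2) * |x| ^ r := by
  rw [abs_mul, abs_of_nonneg (Real.sqrt_nonneg s),
    Real.mul_rpow (Real.sqrt_nonneg s) (abs_nonneg x), Real.sqrt_eq_rpow, ← Real.rpow_mul hs]
  congr 2
  ring

lemma integrable_abs_linear_rpow {r : ℝ} (hr : 0 < r) (c : Fin n → ℝ) :
    Integrable (fun g => |∑ i, c i * g i| ^ r) (gaussVec n) := by
  have hs : 0 ≤ ∑ i, c i ^ 2 := Finset.sum_nonneg fun i _ => sq_nonneg _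
  have hm : Measurable fun x : ℝ => |x| ^ r := by fun_prop
  have h : Integrable (fun x : ℝ => |x| ^ r)
      ((gaussVec n).map fun g => ∑ i, c i * g i) := by
    rw [map_linear_gaussVec, integrable_map_measure hm.aestronglyMeasurable (by fun_prop)]
    simp only [Function.comp_def, abs_sqrt_mul_rpow hs]
    exact (integrable_abs_rpow_gaussianReal hr).const_mul _
  exact h.comp_measurable (measurable_linear c)

lemma integral_abs_linear_rpow (r : ℝ) (c : Fin n → ℝ) :
    ∫ g, |∑ i, c i * g i| ^ r ∂gaussVec n = (∑ i, c i ^ 2) ^ (r / 2) * absMoment r := by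
  have hs : 0 ≤ ∑ i, c i ^ 2 := Finset.sum_nonneg fun i _ => sq_nonneg _
  have hm : Measurable fun x : ℝ => |x| ^ r := by fun_prop
  have h : ∫ x, |x| ^ r ∂(gaussVec n).map (fun g => ∑ i, c i * g i) =
      ∫ g, |∑ i, c i * g i| ^ r ∂gaussVec n :=
    integral_map (measurable_linear c).aemeasurable hm.aestronglyMeasurable
  rw [← h, map_linear_gaussVec, integral_map (by fun_prop) hm.aestronglyMeasurable]
  simp only [abs_sqrt_mul_rpow hs, integral_const_mul, absMoment]

lemma integrable_rpow_of_le_one {Ω : Type*} [MeasurableSpace Ω] {μ : Measure Ω}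
    [IsProbabilityMeasure μ] {F : Ω → ℝ} (hF : ∀ ω, 0 ≤ F ω) (hFint : Integrable F μ) {r : ℝ}
    (h0 : 0 ≤ r) (h1 : r ≤ 1) : Integrable (fun ω => F ω ^ r) μ := by
  refine ((integrable_const (1 : ℝ)).add hFint).mono'
    (hFint.aemeasurable.pow_const r).aestronglyMeasurable (ae_of_all _ fun ω => ?_)
  rw [Real.norm_of_nonneg (Real.rpow_nonneg (hF ω) r), Pi.add_apply]
  calc F ω ^ r ≤ (1 + F ω) ^ r := Real.rpow_le_rpow (hF ω) (by linarith) h0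
    _ ≤ (1 + F ω) ^ (1 : ℝ) := Real.rpow_le_rpow_of_exponent_le (by linarith [hF ω]) h1
    _ = 1 + F ω := Real.rpow_one _

lemma integral_rpow_le_rpow_integral {Ω : Type*} [MeasurableSpace Ω] {μ : Measure Ω}
    [IsProbabilityMeasure μ] {F : Ω → ℝ} (hF : ∀ ω, 0 ≤ F ω) (hFint : Integrable F μ) {r : ℝ}
    (h0 : 0 ≤ r) (h1 : r ≤ 1) : ∫ ω, F ω ^ r ∂μ ≤ (∫ ω, F ω ∂μ) ^ r :=
  (Real.concaveOn_rpow h0 h1).le_map_integral (Real.continuous_rpow_const h0).continuousOn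
    isClosed_Ici (ae_of_all _ hF) hFint (integrable_rpow_of_le_one hF hFint h0 h1)

lemma sum_mul_le_of_mem_Bconj {q q' : ℝ} (hq : q.HolderConjugate q') {t : Fin m → ℝ}
    (ht : t ∈ Bconj q' m) (S : Fin m → ℝ) :
    ∑ k, t k * S k ≤ (∑ k, |S k| ^ q) ^ (1 / q) := by
  have h := Real.inner_le_Lp_mul_Lq Finset.univ t S hq.symm
  have h1 : (∑ k, |t k| ^ q') ^ (1 / q') ≤ 1 :=
    Real.rpow_le_one (Finset.sum_nonneg fun k _ => Real.rpow_nonneg (abs_nonneg _) _) ht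
      (one_div_nonneg.2 hq.symm.nonneg)
  exact h.trans (mul_le_of_le_one_left
    (Real.rpow_nonneg (Finset.sum_nonneg fun k _ => Real.rpow_nonneg (abs_nonneg _) _) _) h1)

lemma iSup_Bconj_le {q q' : ℝ} (hq : q.HolderConjugate q') (S : Fin m → ℝ) :
    ⨆ t ∈ Bconj q' m, ∑ k, t k * S k ≤ (∑ k, |S k| ^ q) ^ (1 / q) := by
  have h0 : 0 ≤ (∑ k, |S k| ^ q) ^ (1 / q) :=
    Real.rpow_nonneg (Finset.sum_nonneg fun k _ => Real.rpow_nonneg (abs_nonneg _) _) _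
  exact Real.iSup_le (fun t => Real.iSup_le (fun ht => sum_mul_le_of_mem_Bconj hq ht S) h0) h0

lemma iSup_Bconj_nonneg (q' : ℝ) (S : Fin m → ℝ) :
    0 ≤ ⨆ t ∈ Bconj q' m, ∑ k, t k * S k := by
  by_cases hb : BddAbove (Set.range fun t => ⨆ (_ : t ∈ Bconj q' m), ∑ k, t k * S k)
  · refine le_ciSup_of_le hb 0 ?_
    simp
  · rw [Real.iSup_of_not_bddAbove hb]

/-- With the convention `1 / 0 = 0`, the set `Bconj 0 m` is either empty or the whole space, and
the real supremum of a linear form over it is `0`. -/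
lemma iSup_Bconj_zero (S : Fin m → ℝ) : ⨆ t ∈ Bconj 0 m, ∑ k, t k * S k = 0 := by
  by_cases hm : (m : ℝ) ≤ 1
  · have hB : ∀ t : Fin m → ℝ, t ∈ Bconj 0 m := fun t => by simpa [Bconj] using hm
    simp only [hB, ciSup_unique]
    by_cases hS : ∃ k, S k ≠ 0
    · obtain ⟨k, hk⟩ := hS
      refine Real.iSup_of_not_bddAbove fun ⟨M, hM⟩ => ?_
      have h := hM ⟨Pi.single k ((M + 1) / S k), rfl⟩
      simp only [Pi.single_apply, ite_mul, zero_mul, Finset.sum_ite_eq', Finset.mem_univ,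
        if_true, div_mul_cancel₀ _ hk] at h
      linarith
    · push Not at hS
      simp [hS]
  · have hB : ∀ t : Fin m → ℝ, t ∉ Bconj 0 m := fun t => by simpa [Bconj] using hm
    simp [hB]

lemma integral_iSup_Bconj_le {q q' : ℝ} (hq : q.HolderConjugate q') (c : Fin m → Fin n → ℝ) :
    ∫ g, (⨆ t ∈ Bconj q' m, ∑ k, t k * ∑ i, c k i * g i) ∂gaussVec n ≤
      absMoment q ^ (1 / q) * (∑ k, (∑ i, c k i ^ 2) ^ (q / 2)) ^ (1 / q) := by
  have hF : ∀ g : Fin n → ℝ, 0 ≤ ∑ k, |∑ i, c k i * g i| ^ q := fun g =>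
    Finset.sum_nonneg fun k _ => Real.rpow_nonneg (abs_nonneg _) _
  have hFint : Integrable (fun g => ∑ k, |∑ i, c k i * g i| ^ q) (gaussVec n) :=
    integrable_finsetSum _ fun k _ => integrable_abs_linear_rpow hq.pos (c k)
  have h0 : 0 ≤ 1 / q := one_div_nonneg.2 hq.nonneg
  have h1 : 1 / q ≤ 1 := (div_le_one hq.pos).2 hq.lt.le
  calc ∫ g, (⨆ t ∈ Bconj q' m, ∑ k, t k * ∑ i, c k i * g i) ∂gaussVec n
      ≤ ∫ g, (∑ k, |∑ i, c k i * g i| ^ q) ^ (1 / q) ∂gaussVec n :=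
        integral_mono_of_nonneg (ae_of_all _ fun g => iSup_Bconj_nonneg q' _)
          (integrable_rpow_of_le_one hF hFint h0 h1) (ae_of_all _ fun g => iSup_Bconj_le hq _)
    _ ≤ (∫ g, ∑ k, |∑ i, c k i * g i| ^ q ∂gaussVec n) ^ (1 / q) :=
        integral_rpow_le_rpow_integral hF hFint h0 h1
    _ = absMoment q ^ (1 / q) * (∑ k, (∑ i, c k i ^ 2) ^ (q / 2)) ^ (1 / q) := by
        rw [integral_finsetSum _ fun k _ => integrable_abs_linear_rpow hq.pos (c k)]
        simp_rw [integral_abs_linear_rpow, ← Finset.sum_mul]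
        rw [mul_comm, Real.mul_rpow (absMoment_nonneg q)]
        exact Finset.sum_nonneg fun k _ =>
          Real.rpow_nonneg (Finset.sum_nonneg fun i _ => sq_nonneg _) _

lemma rpow_sum_le_rpow_sum_mul_rpow_sum {q : ℝ} (hq : 0 < q) {N D G : Fin m → ℝ}
    (hN : ∀ k, 0 ≤ N k) (hD : ∀ k, 0 ≤ D k) (hG : ∀ k, 0 ≤ G k)
    (h : ∀ k, N k ^ 2 ≤ D k * G k) :
    (∑ k, N k ^ (q / 2)) ^ (1 / q) ≤
      (∑ k, D k ^ (q / 2)) ^ (1 / (2 * q)) * (∑ k, G k ^ (q / 2)) ^ (1 / (2 * q)) := by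
  have hsum : (∑ k, N k ^ (q / 2)) ^ 2 ≤ (∑ k, D k ^ (q / 2)) * ∑ k, G k ^ (q / 2) := by
    refine Finset.sum_sq_le_sum_mul_sum_of_sq_le_mul _ (fun k _ => Real.rpow_nonneg (hD k) _)
      (fun k _ => Real.rpow_nonneg (hG k) _) fun k _ => ?_
    rw [← Real.mul_rpow (hD k) (hG k), ← Real.rpow_mul_natCast (hN k), mul_comm (q / 2),
      Real.rpow_natCast_mul (hN k)]
    exact Real.rpow_le_rpow (sq_nonneg _) (h k) (by positivity)
  have hN' : 0 ≤ ∑ k, N k ^ (q / 2) := Finset.sum_nonneg fun k _ => Real.rpow_nonneg (hN k) _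
  have hD' : 0 ≤ ∑ k, D k ^ (q / 2) := Finset.sum_nonneg fun k _ => Real.rpow_nonneg (hD k) _
  have hG' : 0 ≤ ∑ k, G k ^ (q / 2) := Finset.sum_nonneg fun k _ => Real.rpow_nonneg (hG k) _
  rw [← Real.mul_rpow hD' hG']
  calc (∑ k, N k ^ (q / 2)) ^ (1 / q) = ((∑ k, N k ^ (q / 2)) ^ 2) ^ (1 / (2 * q)) := by
        rw [← Real.rpow_natCast_mul hN']
        congr 1
        push_cast
        field_simp
    _ ≤ _ := Real.rpow_le_rpow (sq_nonneg _) hsum (by positivity)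

lemma sq_sum_sq_mul_sq_le {α b : Fin n → ℝ} (hα : ∀ i, 0 < α i) (g : Fin n → ℝ) :
    (∑ i, (g i * b i) ^ 2) ^ 2 ≤ (∑ i, b i ^ 4 / α i) * ∑ i, α i * g i ^ 4 := by
  refine Finset.sum_sq_le_sum_mul_sum_of_sq_le_mul _
    (fun i _ => div_nonneg (by positivity) (hα i).le)
    (fun i _ => mul_nonneg (hα i).le (by positivity)) fun i _ => le_of_eq ?_
  have := (hα i).ne'
  field_simp

lemma rpow_half_weighted_sum_le {q : ℝ} (hq : 1 ≤ q) {w f : Fin n → ℝ} (hw : ∀ i, 0 ≤ w i)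
    (hf : ∀ i, 0 ≤ f i) :
    (∑ i, w i * f i) ^ (q / 2) ≤
      (∑ i, w i) ^ ((q - 1) / 2) * (∑ i, w i * f i ^ q) ^ (1 / 2 : ℝ) := by
  have hq0 : 0 < q := by linarith
  have hW : 0 ≤ ∑ i, w i := Finset.sum_nonneg fun i _ => hw i
  have hX : 0 ≤ ∑ i, w i * f i := Finset.sum_nonneg fun i _ => mul_nonneg (hw i) (hf i)
  have hY : 0 ≤ ∑ i, w i * f i ^ q :=
    Finset.sum_nonneg fun i _ => mul_nonneg (hw i) (Real.rpow_nonneg (hf i) _)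
  have h := Real.rpow_le_rpow hX
    (Real.inner_le_weight_mul_Lp_of_nonneg Finset.univ hq w f hw hf) (by positivity : 0 ≤ q / 2)
  rw [Real.mul_rpow (Real.rpow_nonneg hW _) (Real.rpow_nonneg hY _), ← Real.rpow_mul hW,
    ← Real.rpow_mul hY] at h
  convert h using 3 <;> field_simp

lemma gaussVec_fourth_powers {q : ℝ} (hq : 1 ≤ q) {w : Fin n → ℝ} (hw : ∀ i, 0 ≤ w i) :
    Integrable (fun g : Fin n → ℝ => (∑ i, w i * g i ^ 4) ^ (q / 2)) (gaussVec n) ∧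
      ∫ g, (∑ i, w i * g i ^ 4) ^ (q / 2) ∂gaussVec n ≤
        absMoment (4 * q) ^ (1 / 2 : ℝ) * (∑ i, w i) ^ (q / 2) := by
  have hq0 : 0 < 4 * q := by linarith
  have hW : 0 ≤ ∑ i, w i := Finset.sum_nonneg fun i _ => hw i
  have hF : ∀ g : Fin n → ℝ, 0 ≤ ∑ i, w i * |g i| ^ (4 * q) := fun g =>
    Finset.sum_nonneg fun i _ => mul_nonneg (hw i) (Real.rpow_nonneg (abs_nonneg _) _)
  have hcoord : ∀ i : Fin n,
      Integrable (fun g : Fin n → ℝ => w i * |g i| ^ (4 * q)) (gaussVec n) := fun i =>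
    (integrable_comp_eval (μ := fun _ : Fin n => gaussianReal 0 1)
      (integrable_abs_rpow_gaussianReal hq0)).const_mul _
  have hFint : Integrable (fun g : Fin n → ℝ => ∑ i, w i * |g i| ^ (4 * q)) (gaussVec n) :=
    integrable_finsetSum _ fun i _ => hcoord i
  have hle : ∀ g : Fin n → ℝ, (∑ i, w i * g i ^ 4) ^ (q / 2) ≤
      (∑ i, w i) ^ ((q - 1) / 2) * (∑ i, w i * |g i| ^ (4 * q)) ^ (1 / 2 : ℝ) := by
    intro g
    convert rpow_half_weighted_sum_le hq hw (f := fun i => g i ^ 4) (fun i => by positivity)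
      using 5 with i
    rw [← Even.pow_abs (by decide : Even 4), ← Real.rpow_natCast_mul (abs_nonneg _)]
    norm_num
  have h0 : ∀ g : Fin n → ℝ, 0 ≤ (∑ i, w i * g i ^ 4) ^ (q / 2) := fun g =>
    Real.rpow_nonneg (Finset.sum_nonneg fun i _ => mul_nonneg (hw i) (by positivity)) _
  have hdom := (integrable_rpow_of_le_one hF hFint (r := 1 / 2) (by norm_num)
    (by norm_num)).const_mul ((∑ i, w i) ^ ((q - 1) / 2))
  have hmeas : Measurable fun g : Fin n → ℝ => (∑ i, w i * g i ^ 4) ^ (q / 2) := by fun_prop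
  refine ⟨hdom.mono' hmeas.aestronglyMeasurable (ae_of_all _ fun g => ?_), ?_⟩
  · rw [Real.norm_of_nonneg (h0 g)]
    exact hle g
  have hsum : ∫ g, ∑ i, w i * |g i| ^ (4 * q) ∂gaussVec n = (∑ i, w i) * absMoment (4 * q) := by
    rw [integral_finsetSum _ fun i _ => hcoord i, Finset.sum_mul]
    refine Finset.sum_congr rfl fun i _ => ?_
    rw [integral_const_mul, gaussVec, integral_comp_eval (μ := fun _ : Fin n => gaussianReal 0 1)
      (integrable_abs_rpow_gaussianReal hq0).aestronglyMeasurable, absMoment]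
  calc ∫ g, (∑ i, w i * g i ^ 4) ^ (q / 2) ∂gaussVec n
      ≤ (∑ i, w i) ^ ((q - 1) / 2) *
          ∫ g, (∑ i, w i * |g i| ^ (4 * q)) ^ (1 / 2 : ℝ) ∂gaussVec n := by
        rw [← integral_const_mul]
        exact integral_mono_of_nonneg (ae_of_all _ h0) hdom (ae_of_all _ hle)
    _ ≤ (∑ i, w i) ^ ((q - 1) / 2) * ((∑ i, w i) * absMoment (4 * q)) ^ (1 / 2 : ℝ) := by
        rw [← hsum]
        gcongr
        exact integral_rpow_le_rpow_integral hF hFint (by norm_num) (by norm_num)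
    _ = absMoment (4 * q) ^ (1 / 2 : ℝ) * (∑ i, w i) ^ (q / 2) := by
        rw [Real.mul_rpow hW (absMoment_nonneg _), ← mul_assoc,
          ← Real.rpow_add_of_nonneg hW (by linarith) (by norm_num), mul_comm]
        congr 2
        ring

lemma gaussVec_rpow_sum_fourth_powers {q : ℝ} (hq : 1 ≤ q) {w : Fin m → Fin n → ℝ}
    (hw : ∀ k i, 0 ≤ w k i) :
    Integrable (fun g : Fin n → ℝ =>
        (∑ k, (∑ i, w k i * g i ^ 4) ^ (q / 2)) ^ (1 / (2 * q))) (gaussVec n) ∧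
      ∫ g, (∑ k, (∑ i, w k i * g i ^ 4) ^ (q / 2)) ^ (1 / (2 * q)) ∂gaussVec n ≤
        (absMoment (4 * q) ^ (1 / 2 : ℝ)) ^ (1 / (2 * q)) *
          (∑ k, (∑ i, w k i) ^ (q / 2)) ^ (1 / (2 * q)) := by
  have hq0 : 0 < q := by linarith
  have h0 : 0 ≤ 1 / (2 * q) := by positivity
  have h1 : 1 / (2 * q) ≤ 1 := (div_le_one (by positivity)).2 (by linarith)
  have hF : ∀ g : Fin n → ℝ, 0 ≤ ∑ k, (∑ i, w k i * g i ^ 4) ^ (q / 2) := fun g =>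
    Finset.sum_nonneg fun k _ => Real.rpow_nonneg
      (Finset.sum_nonneg fun i _ => mul_nonneg (hw k i) (by positivity)) _
  have hFint : Integrable (fun g : Fin n → ℝ => ∑ k, (∑ i, w k i * g i ^ 4) ^ (q / 2))
      (gaussVec n) := integrable_finsetSum _ fun k _ => (gaussVec_fourth_powers hq (hw k)).1
  refine ⟨integrable_rpow_of_le_one hF hFint h0 h1,
    (integral_rpow_le_rpow_integral hF hFint h0 h1).trans ?_⟩
  rw [← Real.mul_rpow (Real.rpow_nonneg (absMoment_nonneg _) _) (Finset.sum_nonneg fun k _ =>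
    Real.rpow_nonneg (Finset.sum_nonneg fun i _ => hw k i) _)]
  refine Real.rpow_le_rpow (integral_nonneg hF) ?_ h0
  rw [integral_finsetSum _ fun k _ => (gaussVec_fourth_powers hq (hw k)).1, Finset.mul_sum]
  exact Finset.sum_le_sum fun k _ => (gaussVec_fourth_powers hq (hw k)).2

lemma phiA_nonneg (q : ℝ) (A : Fin n → Fin n → Fin m → ℝ) (x : Fin n → ℝ) : 0 ≤ phiA q A x := by
  refine Real.rpow_nonneg (Finset.sum_nonneg fun k _ => Real.rpow_nonneg
    (Finset.sum_nonneg fun i _ => div_nonneg (by positivity) ?_) _) _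
  exact Finset.sum_nonneg fun j _ => sq_nonneg _

lemma continuous_phiA {q : ℝ} (hq : 0 ≤ q) (A : Fin n → Fin n → Fin m → ℝ) :
    Continuous (phiA q A) := by
  unfold phiA
  refine Continuous.rpow_const (continuous_finsetSum _ fun k _ =>
    Continuous.rpow_const (by fun_prop) fun _ => Or.inr (by positivity))
      fun _ => Or.inr (by positivity)

lemma abs_apply_le_of_mem_UB {p : ℝ} {x : Fin n → ℝ} (hx : x ∈ UB n p) (i : Fin n) :
    |x i| ≤ 1 + √p := by
  obtain ⟨y, hy, _, ⟨z, hz, rfl⟩, rfl⟩ := hx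
  have hyi : |y i| ≤ 1 := (Real.abs_le_sqrt
    (Finset.single_le_sum (f := fun i => y i ^ 2) (fun j _ => sq_nonneg _)
      (Finset.mem_univ i))).trans hy
  have hzi : |z i| ≤ 1 := (Finset.single_le_sum (f := fun i => |z i|)
    (fun j _ => abs_nonneg _) (Finset.mem_univ i)).trans hz
  calc |y i + √p * z i| ≤ |y i| + |√p * z i| := abs_add_le _ _
    _ = |y i| + √p * |z i| := by rw [abs_mul, abs_of_nonneg (Real.sqrt_nonneg p)]
    _ ≤ 1 + √p * 1 := by gcongr
    _ = 1 + √p := by rw [mul_one]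

lemma phiA_le_iSup {q p : ℝ} (hq : 0 ≤ q) (A : Fin n → Fin n → Fin m → ℝ)
    {U : Set (Fin n → ℝ)} (hU : U ⊆ UB n p) {x : Fin n → ℝ} (hx : x ∈ U) :
    phiA q A x ≤ ⨆ y ∈ U, phiA q A y := by
  obtain ⟨M, hM⟩ := (isCompact_univ_pi fun _ : Fin n =>
    isCompact_Icc (a := -(1 + √p)) (b := 1 + √p)).bddAbove_image
      (continuous_phiA hq A).continuousOn
  have hb : BddAbove (Set.range fun y => ⨆ (_ : y ∈ U), phiA q A y) := by
    refine ⟨max M 0, ?_⟩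
    rintro _ ⟨y, rfl⟩
    refine Real.iSup_le (fun hy => le_max_of_le_left (hM ⟨y, fun i _ => ?_, rfl⟩))
      (le_max_right _ _)
    exact abs_le.1 (abs_apply_le_of_mem_UB (hU hy) i)
  refine le_ciSup_of_le hb x ?_
  simp [hx]

lemma quadrilinear_sum_eq (A : Fin n → Fin n → Fin m → ℝ) (g g' x : Fin n → ℝ) (t : Fin m → ℝ) :
    ∑ i, ∑ j, ∑ k, A i j k * g i * g' i * x j * t k =
      ∑ k, t k * ∑ i, (g i * ∑ j, A i j k * x j) * g' i := by
  simp_rw [Finset.mul_sum, Finset.sum_mul, Finset.mul_sum]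
  conv_rhs => rw [Finset.sum_comm]
  refine Finset.sum_congr rfl fun i _ => ?_
  rw [Finset.sum_comm]
  exact Finset.sum_congr rfl fun k _ => Finset.sum_congr rfl fun j _ => by ring

lemma integral_iSup_Bconj_le_phiA {q q' : ℝ} (hq : q.HolderConjugate q')
    {A : Fin n → Fin n → Fin m → ℝ} (hA : ∀ i k, 0 < ∑ j, A i j k ^ 2) (g x : Fin n → ℝ) :
    ∫ g', (⨆ t ∈ Bconj q' m,
        ∑ k, t k * ∑ i, (g i * ∑ j, A i j k * x j) * g' i) ∂gaussVec n ≤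
      absMoment q ^ (1 / q) * (phiA q A x *
        (∑ k, (∑ i, (∑ j, A i j k ^ 2) * g i ^ 4) ^ (q / 2)) ^ (1 / (2 * q))) := by
  refine (integral_iSup_Bconj_le hq fun k i => g i * ∑ j, A i j k * x j).trans
    (mul_le_mul_of_nonneg_left ?_ (Real.rpow_nonneg (absMoment_nonneg q) _))
  exact rpow_sum_le_rpow_sum_mul_rpow_sum hq.pos
    (fun k => Finset.sum_nonneg fun i _ => sq_nonneg _)
    (fun k => Finset.sum_nonneg fun i _ => div_nonneg (by positivity) (hA i k).le)
    (fun k => Finset.sum_nonneg fun i _ => mul_nonneg (hA i k).le (by positivity))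
    fun k => sq_sum_sq_mul_sq_le (fun i => hA i k) g

/-- iterated Gaussian supremum bound. -/
theorem statement_10 :
    ∀ q q' : ℝ, 1 ≤ q → 1 / q + 1 / q' = 1 →
    ∃ C : ℝ, 0 < C ∧
      ∀ (n m : ℕ) (A : Fin n → Fin n → Fin m → ℝ),
        (∀ i k, 0 < ∑ j, A i j k ^ 2) →
      ∀ p : ℝ, 1 ≤ p → ∀ U : Set (Fin n → ℝ), U ⊆ UB n p →
        (∫ g, (⨆ x ∈ U, ∫ g', (⨆ t ∈ Bconj q' m,
            ∑ i, ∑ j, ∑ k, A i j k * g i * g' i * x j * t k) ∂gaussVec n) ∂gaussVec n)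
        ≤ C * (∑ k, (∑ i, ∑ j, A i j k ^ 2) ^ (q / 2)) ^ (1 / (2 * q)) *
            ⨆ x ∈ U, phiA q A x := by
  intro q q' hq hqq'
  set C := absMoment q ^ (1 / q) * (absMoment (4 * q) ^ (1 / 2 : ℝ)) ^ (1 / (2 * q)) with hC
  have hM : 0 ≤ absMoment q ^ (1 / q) := Real.rpow_nonneg (absMoment_nonneg _) _
  have hC0 : 0 ≤ C := mul_nonneg hM
    (Real.rpow_nonneg (Real.rpow_nonneg (absMoment_nonneg _) _) _)
  refine ⟨C + 1, by linarith, fun n m A hA p _ U hU => ?_⟩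
  simp_rw [quadrilinear_sum_eq]
  set R := (∑ k, (∑ i, ∑ j, A i j k ^ 2) ^ (q / 2)) ^ (1 / (2 * q))
  set Φ := ⨆ x ∈ U, phiA q A x
  have hR0 : 0 ≤ R := Real.rpow_nonneg (Finset.sum_nonneg fun k _ => Real.rpow_nonneg
    (Finset.sum_nonneg fun i _ => (hA i k).le) _) _
  have hΦ0 : 0 ≤ Φ := Real.iSup_nonneg fun x => Real.iSup_nonneg fun _ => phiA_nonneg q A x
  rcases hq.eq_or_lt with rfl | hq1
  · obtain rfl : q' = 0 := by simpa using hqq'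
    simp only [iSup_Bconj_zero, integral_zero, Real.iSup_const_zero]
    positivity
  have hconj : q.HolderConjugate q' :=
    Real.holderConjugate_iff.2 ⟨hq1, by simpa [one_div] using hqq'⟩
  have hw : ∀ (k : Fin m) (i : Fin n), 0 ≤ ∑ j, A i j k ^ 2 := fun k i => (hA i k).le
  obtain ⟨hHint, hHle⟩ := gaussVec_rpow_sum_fourth_powers hq hw
  set H : (Fin n → ℝ) → ℝ := fun g =>
    (∑ k, (∑ i, (∑ j, A i j k ^ 2) * g i ^ 4) ^ (q / 2)) ^ (1 / (2 * q))
  have hH0 : ∀ g, 0 ≤ H g := fun g => Real.rpow_nonneg (Finset.sum_nonneg fun k _ =>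
    Real.rpow_nonneg (Finset.sum_nonneg fun i _ => mul_nonneg (hw k i) (by positivity)) _) _
  have hbound : ∀ g : Fin n → ℝ, (⨆ x ∈ U, ∫ g', (⨆ t ∈ Bconj q' m,
      ∑ k, t k * ∑ i, (g i * ∑ j, A i j k * x j) * g' i) ∂gaussVec n) ≤
        absMoment q ^ (1 / q) * Φ * H g := by
    intro g
    have hnn : 0 ≤ absMoment q ^ (1 / q) * Φ * H g := mul_nonneg (mul_nonneg hM hΦ0) (hH0 g)
    refine Real.iSup_le (fun x => Real.iSup_le (fun hx => ?_) hnn) hnn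
    rw [mul_assoc]
    exact (integral_iSup_Bconj_le_phiA hconj hA g x).trans (mul_le_mul_of_nonneg_left
      (mul_le_mul_of_nonneg_right (phiA_le_iSup hconj.nonneg A hU hx) (hH0 g)) hM)
  calc _ ≤ ∫ g, absMoment q ^ (1 / q) * Φ * H g ∂gaussVec n :=
        integral_mono_of_nonneg (ae_of_all _ fun g => Real.iSup_nonneg fun x =>
          Real.iSup_nonneg fun _ => integral_nonneg fun g' => iSup_Bconj_nonneg q' _)
          (hHint.const_mul _) (ae_of_all _ hbound)
    _ = absMoment q ^ (1 / q) * Φ * ∫ g, H g ∂gaussVec n := integral_const_mul _ _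
    _ ≤ absMoment q ^ (1 / q) * Φ *
          ((absMoment (4 * q) ^ (1 / 2 : ℝ)) ^ (1 / (2 * q)) * R) :=
        mul_le_mul_of_nonneg_left hHle (mul_nonneg hM hΦ0)
    _ = C * R * Φ := by rw [hC]; ring
    _ ≤ (C + 1) * R * Φ := by gcongr; linarith

end Stmt10
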